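/- For every integer k ≥ 5, the real vector space Z^k(T̂) = {v ∈ (P^k)² : v vanishes on ∂T̂ and ∂₁v₁ + ∂₂v₂ = 0 identically} has dimension (k−4)(k−3)/2. -/

import Mathlib

open MvPolynomial

/-- `(x,y)` lies on the boundary of the reference triangle. -/
def OnBdryT (x y : ℝ) : Prop :=
  0 ≤ x ∧ 0 ≤ y ∧ x + y ≤ 1 ∧ (x = 0 ∨ y = 0 ∨ x + y = 1)

/-- `Z^k(T̂)`: the space of pairs of polynomials of total degree at most `k` that vanish on
the boundary of the reference triangle and are divergence free (`∂₁v₁ + ∂₂v₂ = 0`). -/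
noncomputable def Zspace (k : ℕ) :
    Submodule ℝ (MvPolynomial (Fin 2) ℝ × MvPolynomial (Fin 2) ℝ) where
  carrier := {v | v.1.totalDegree ≤ k ∧ v.2.totalDegree ≤ k ∧
    (∀ x y : ℝ, OnBdryT x y → eval ![x, y] v.1 = 0 ∧ eval ![x, y] v.2 = 0) ∧
    pderiv (0 : Fin 2) v.1 + pderiv (1 : Fin 2) v.2 = 0}
  zero_mem' := by simp
  add_mem' := by
    rintro a b ⟨ha1, ha2, ha3, ha4⟩ ⟨hb1, hb2, hb3, hb4⟩
    refine ⟨le_trans (totalDegree_add _ _) (max_le ha1 hb1),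
      le_trans (totalDegree_add _ _) (max_le ha2 hb2), ?_, ?_⟩
    · intro x y hxy
      obtain ⟨e1, e2⟩ := ha3 x y hxy
      obtain ⟨f1, f2⟩ := hb3 x y hxy
      simp [e1, e2, f1, f2]
    · simp only [Prod.fst_add, Prod.snd_add, map_add]
      calc pderiv (0 : Fin 2) a.1 + pderiv (0 : Fin 2) b.1 +
            (pderiv (1 : Fin 2) a.2 + pderiv (1 : Fin 2) b.2)
          = (pderiv (0 : Fin 2) a.1 + pderiv (1 : Fin 2) a.2) +
            (pderiv (0 : Fin 2) b.1 + pderiv (1 : Fin 2) b.2) := by ring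
        _ = 0 := by rw [ha4, hb4, add_zero]
  smul_mem' := by
    rintro c a ⟨ha1, ha2, ha3, ha4⟩
    refine ⟨le_trans (totalDegree_smul_le _ _) ha1,
      le_trans (totalDegree_smul_le _ _) ha2, ?_, ?_⟩
    · intro x y hxy
      obtain ⟨e1, e2⟩ := ha3 x y hxy
      simp [smul_eval, e1, e2]
    · simp only [Prod.smul_fst, Prod.smul_snd, Derivation.map_smul]
      rw [← smul_add, ha4, smul_zero]

namespace MvPolynomial

section PartialDerivative

variable {σ : Type*}

theorem totalDegree_pderiv_le {R : Type*} [CommSemiring R] (i : σ) {p : MvPolynomial σ R} {d : ℕ}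
    (hp : p.totalDegree ≤ d + 1) : (pderiv i p).totalDegree ≤ d := by
  refine Finset.sup_le fun m hm => ?_
  rw [mem_support_iff, coeff_pderiv] at hm
  have h := (le_totalDegree (mem_support_iff.2 (left_ne_zero_of_mul hm))).trans hp
  rw [Finsupp.sum_add_index' (fun _ => rfl) (fun _ _ _ => rfl),
    Finsupp.sum_single_index rfl] at h
  omega

theorem pderiv_pderiv_comm {R : Type*} [CommSemiring R] (i j : σ) (p : MvPolynomial σ R) :
    pderiv i (pderiv j p) = pderiv j (pderiv i p) := by
  classical
  obtain rfl | h := eq_or_ne i j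
  · rfl
  · ext m
    simp [coeff_pderiv, add_right_comm m, h, h.symm]
    ring

/-- The formal antiderivative in the variable `i` without terms free of `X i`. -/
noncomputable def antideriv (K : Type*) [Field K] (i : σ) :
    MvPolynomial σ K →ₗ[K] MvPolynomial σ K :=
  (basisMonomials σ K).constr K fun s => monomial (s + Finsupp.single i 1) ((s i : K) + 1)⁻¹

variable {K : Type*} [Field K]

theorem antideriv_monomial (i : σ) (s : σ →₀ ℕ) (a : K) :
    antideriv K i (monomial s a) =
      monomial (s + Finsupp.single i 1) (a * ((s i : K) + 1)⁻¹) := by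
  have h : (monomial s a : MvPolynomial σ K) = a • basisMonomials σ K s := by
    simp [smul_monomial]
  rw [h, map_smul, antideriv, Module.Basis.constr_basis, smul_monomial, smul_eq_mul]

theorem X_dvd_antideriv (i : σ) (p : MvPolynomial σ K) : X i ∣ antideriv K i p := by
  induction p using MvPolynomial.induction_on' with
  | monomial s a =>
    rw [antideriv_monomial, monomial_add_single, pow_one]
    exact dvd_mul_left _ _
  | add p q hp hq => rw [map_add]; exact dvd_add hp hq

theorem totalDegree_antideriv_le (i : σ) (p : MvPolynomial σ K) :
    (antideriv K i p).totalDegree ≤ p.totalDegree + 1 := by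
  conv_lhs => rw [p.as_sum, map_sum]
  refine totalDegree_finsetSum_le fun s hs => ?_
  rw [antideriv_monomial]
  refine (totalDegree_monomial_le _ _).trans ?_
  rw [Finsupp.sum_add_index' (fun _ => rfl) (fun _ _ _ => rfl), Finsupp.sum_single_index rfl]
  exact Nat.add_le_add_right (le_totalDegree hs) 1

theorem antideriv_X_mul {i j : σ} (h : j ≠ i) (p : MvPolynomial σ K) :
    antideriv K i (X j * p) = X j * antideriv K i p := by
  induction p using MvPolynomial.induction_on' with
  | monomial s a =>
    simp [X, antideriv_monomial, monomial_mul, h, add_assoc]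
  | add p q hp hq => simp [mul_add, hp, hq]

variable [CharZero K]

theorem pderiv_antideriv (i : σ) (p : MvPolynomial σ K) : pderiv i (antideriv K i p) = p := by
  induction p using MvPolynomial.induction_on' with
  | monomial s a =>
    have : (s i : K) + 1 ≠ 0 := Nat.cast_add_one_ne_zero _
    simp [antideriv_monomial, this]
  | add p q hp hq => simp [hp, hq]

theorem antideriv_pderiv {i : σ} {p : MvPolynomial σ K} (hp : X i ∣ p) :
    antideriv K i (pderiv i p) = p := by
  obtain ⟨q, rfl⟩ := hp
  induction q using MvPolynomial.induction_on' with
  | monomial s a =>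
    have : (1 + (s i : K)) ≠ 0 := by rw [add_comm]; exact Nat.cast_add_one_ne_zero _
    simp [X, antideriv_monomial, monomial_mul, -Derivation.leibniz, add_comm, this]
  | add p q hp hq => rw [mul_add, map_add, map_add, hp, hq]

/-- A polynomial divisible by `X i` whose `i`-th partial derivative vanishes is zero. -/
theorem eq_zero_of_X_dvd_of_pderiv_eq_zero {i : σ} {p : MvPolynomial σ K} (hp : X i ∣ p)
    (h : pderiv i p = 0) : p = 0 := by
  rw [← antideriv_pderiv hp, h, map_zero]

end PartialDerivative

/-- If a polynomial and one of its partial derivatives are divisible by `l`, and that partial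
derivative of `l` is a unit, then the polynomial is divisible by `l ^ 2`. -/
theorem sq_dvd_of_dvd_of_dvd_pderiv {σ R : Type*} [CommRing R] {l p : MvPolynomial σ R} (i : σ)
    (hl : IsUnit (pderiv i l)) (hp : l ∣ p) (hp' : l ∣ pderiv i p) : l ^ 2 ∣ p := by
  obtain ⟨q, rfl⟩ := hp
  rw [pderiv_mul, dvd_add_left (dvd_mul_right _ _), hl.dvd_mul_left] at hp'
  rw [sq]
  exact mul_dvd_mul_left l hp'

theorem derivative_aeval {σ R : Type*} [Fintype σ] [CommSemiring R] (g : σ → Polynomial R)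
    (p : MvPolynomial σ R) :
    Polynomial.derivative (aeval g p) =
      ∑ i, aeval g (pderiv i p) * Polynomial.derivative (g i) := by
  classical
  induction p using MvPolynomial.induction_on with
  | C a => simp
  | add p q hp hq => simp [hp, hq, add_mul, Finset.sum_add_distrib]
  | mul_X p j hp =>
    have h (i : σ) : aeval g (pderiv i (p * X j)) * Polynomial.derivative (g i) =
        aeval g (pderiv i p) * Polynomial.derivative (g i) * g j +
          if j = i then aeval g p * Polynomial.derivative (g i) else 0 := by
      rw [pderiv_mul, pderiv_X, Pi.single_apply]
      split_ifs <;> simp <;> ring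
    simp [-Derivation.leibniz, h, hp, Finset.sum_add_distrib, Finset.sum_mul]

/-- If modulo `l` each variable is the value at `t` of a univariate polynomial `g i`, then `l`
divides every polynomial annihilated by the substitution `X i ↦ g i`. -/
theorem dvd_of_aeval_eq_zero {σ R : Type*} [CommRing R] {l t : MvPolynomial σ R}
    {g : σ → Polynomial R} (hl : ∀ i, l ∣ X i - Polynomial.aeval t (g i))
    {p : MvPolynomial σ R} (hp : aeval g p = 0) : l ∣ p := by
  have h : (Ideal.Quotient.mkₐ R (Ideal.span {l})) =
      ((Ideal.Quotient.mkₐ R (Ideal.span {l})).comp (Polynomial.aeval t)).comp (aeval g) := by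
    ext i
    simp only [AlgHom.comp_apply, aeval_X, Ideal.Quotient.mkₐ_eq_mk]
    rw [Ideal.Quotient.mk_eq_mk_iff_sub_mem, Ideal.mem_span_singleton]
    exact hl i
  have := congrArg (fun f => f p) h
  simp only [AlgHom.comp_apply, hp, map_zero, Ideal.Quotient.mkₐ_eq_mk] at this
  rwa [Ideal.Quotient.eq_zero_iff_mem, Ideal.mem_span_singleton] at this

theorem aeval_eq_zero_of_eval_eq_zero_on_Icc {σ : Type*} {g : σ → Polynomial ℝ}
    {p : MvPolynomial σ ℝ} (h : ∀ s ∈ Set.Icc (0 : ℝ) 1, eval (fun i => (g i).eval s) p = 0) :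
    aeval g p = 0 := by
  refine Polynomial.eq_zero_of_infinite_isRoot _ ((Set.Icc_infinite zero_lt_one).mono ?_)
  intro s hs
  have : (Polynomial.aeval s).comp (aeval g) = aeval (R := ℝ) fun i => (g i).eval s := by
    ext i; simp
  have := congrArg (fun f => f p) this
  simp only [AlgHom.comp_apply, Polynomial.coe_aeval_eq_eval] at this
  exact this.trans (h s hs)

theorem finrank_restrictTotalDegree_fin_two (K : Type*) [Field K] (n : ℕ) :
    Module.finrank K (restrictTotalDegree (Fin 2) K n) = (n + 1) * (n + 2) / 2 := by
  have e : {s : Fin 2 →₀ ℕ | (s.sum fun _ e => e) ≤ n} ≃ {p : ℕ × ℕ // p.1 + p.2 ≤ n} :=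
    (Finsupp.equivFunOnFinite.trans (finTwoArrowEquiv ℕ)).subtypeEquiv fun s => by
      simp [Finsupp.sum_fintype]
  rw [restrictTotalDegree, Module.finrank_eq_nat_card_basis (basisRestrictSupport K _),
    Nat.card_congr e, Nat.subtype_card
      ((Finset.range (n + 1)).biUnion Finset.HasAntidiagonal.antidiagonal) fun p => by simp,
    Finset.card_biUnion fun i _ j _ hij => ?_]
  · simp only [Finset.Nat.card_antidiagonal]
    have h := Finset.sum_range_id_mul_two (n + 2)
    rw [Finset.sum_range_succ', add_zero] at h
    rw [mul_comm (n + 1), show n + 1 = n + 2 - 1 from rfl, ← h, Nat.mul_div_cancel _ two_pos]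
    rfl
  · rw [Function.onFun, Finset.disjoint_left]
    intro p hp hp'
    rw [Finset.HasAntidiagonal.mem_antidiagonal] at hp hp'
    exact hij (hp.symm.trans hp')

end MvPolynomial

/-- The product of the two coordinates and `1 - x - y`. -/
noncomputable def bubble : MvPolynomial (Fin 2) ℝ := X 0 * X 1 * (1 - X 0 - X 1)

theorem totalDegree_one_sub_X_sub_X :
    (1 - X 0 - X 1 : MvPolynomial (Fin 2) ℝ).totalDegree = 1 := by
  apply le_antisymm
  · refine (totalDegree_sub _ _).trans (max_le ((totalDegree_sub _ _).trans ?_) ?_) <;> simp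
  · have h : Finsupp.single 0 1 ∈ (1 - X 0 - X 1 : MvPolynomial (Fin 2) ℝ).support := by
      simp [coeff_one, coeff_X, Finsupp.single_left_inj, eq_comm]
    simpa using le_totalDegree h

theorem one_sub_X_sub_X_ne_zero : (1 - X 0 - X 1 : MvPolynomial (Fin 2) ℝ) ≠ 0 := by
  intro h
  simpa [h] using totalDegree_one_sub_X_sub_X

theorem bubble_ne_zero : bubble ≠ 0 :=
  mul_ne_zero (mul_ne_zero (X_ne_zero 0) (X_ne_zero 1)) one_sub_X_sub_X_ne_zero

theorem totalDegree_bubble : bubble.totalDegree = 3 := by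
  rw [bubble, totalDegree_mul_of_isDomain (mul_ne_zero (X_ne_zero 0) (X_ne_zero 1))
    one_sub_X_sub_X_ne_zero, totalDegree_mul_of_isDomain (X_ne_zero 0) (X_ne_zero 1),
    totalDegree_X, totalDegree_X, totalDegree_one_sub_X_sub_X]

theorem totalDegree_bubble_sq_mul {q : MvPolynomial (Fin 2) ℝ} (hq : q ≠ 0) :
    (bubble ^ 2 * q).totalDegree = 6 + q.totalDegree := by
  rw [totalDegree_mul_of_isDomain (pow_ne_zero 2 bubble_ne_zero) hq, sq,
    totalDegree_mul_of_isDomain bubble_ne_zero bubble_ne_zero, totalDegree_bubble]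

theorem eval_bubble_eq_zero {x y : ℝ} (h : OnBdryT x y) : eval ![x, y] bubble = 0 := by
  obtain ⟨-, -, -, h | h | h⟩ := h
  · simp [bubble, h]
  · simp [bubble, h]
  · have : 1 - x - y = 0 := by linarith
    simp [bubble, this]

theorem X_zero_dvd {p : MvPolynomial (Fin 2) ℝ}
    (h : ∀ x y : ℝ, OnBdryT x y → eval ![x, y] p = 0) : X 0 ∣ p := by
  refine dvd_of_aeval_eq_zero (g := ![0, Polynomial.X]) (t := X 1) (fun i => ?_)
    (aeval_eq_zero_of_eval_eq_zero_on_Icc fun s hs => ?_)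
  · fin_cases i <;> simp
  · convert h 0 s ⟨le_rfl, hs.1, by linarith [hs.2], by simp⟩ using 3
    funext i; fin_cases i <;> simp

theorem X_one_dvd {p : MvPolynomial (Fin 2) ℝ}
    (h : ∀ x y : ℝ, OnBdryT x y → eval ![x, y] p = 0) : X 1 ∣ p := by
  refine dvd_of_aeval_eq_zero (g := ![Polynomial.X, 0]) (t := X 0) (fun i => ?_)
    (aeval_eq_zero_of_eval_eq_zero_on_Icc fun s hs => ?_)
  · fin_cases i <;> simp
  · convert h s 0 ⟨hs.1, le_rfl, by linarith [hs.2], by simp⟩ using 3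
    funext i; fin_cases i <;> simp

theorem one_sub_X_sub_X_dvd_of_aeval_eq_zero {p : MvPolynomial (Fin 2) ℝ}
    (h : aeval ![1 - Polynomial.X, (Polynomial.X : Polynomial ℝ)] p = 0) :
    1 - X 0 - X 1 ∣ p := by
  refine dvd_of_aeval_eq_zero (t := X 1) (fun i => ?_) h
  fin_cases i
  · exact ⟨-1, by simp; ring⟩
  · simp

theorem aeval_hypotenuse_eq_zero {p : MvPolynomial (Fin 2) ℝ}
    (h : ∀ x y : ℝ, OnBdryT x y → eval ![x, y] p = 0) :
    aeval ![1 - Polynomial.X, (Polynomial.X : Polynomial ℝ)] p = 0 := by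
  refine aeval_eq_zero_of_eval_eq_zero_on_Icc fun s hs => ?_
  convert h (1 - s) s ⟨by linarith [hs.2], hs.1, by linarith, by simp⟩ using 3
  funext i; fin_cases i <;> simp

theorem bubble_sq_dvd {p : MvPolynomial (Fin 2) ℝ} (h0 : X 0 ^ 2 ∣ p) (h1 : X 1 ^ 2 ∣ p)
    (h2 : (1 - X 0 - X 1) ^ 2 ∣ p) : bubble ^ 2 ∣ p := by
  have not_dvd : ∀ {l m : MvPolynomial (Fin 2) ℝ} (x y : ℝ), eval ![x, y] l = 0 →
      eval ![x, y] m ≠ 0 → ¬ l ∣ m := by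
    rintro l _ x y hl hm ⟨c, rfl⟩
    simp [hl] at hm
  have r01 : IsRelPrime (X 0 : MvPolynomial (Fin 2) ℝ) (X 1) :=
    X_prime.irreducible.isRelPrime_iff_not_dvd.2 (not_dvd 0 1 (by simp) (by simp))
  have r0 : IsRelPrime (X 0 : MvPolynomial (Fin 2) ℝ) (1 - X 0 - X 1) :=
    X_prime.irreducible.isRelPrime_iff_not_dvd.2 (not_dvd 0 0 (by simp) (by simp))
  have r1 : IsRelPrime (X 1 : MvPolynomial (Fin 2) ℝ) (1 - X 0 - X 1) :=
    X_prime.irreducible.isRelPrime_iff_not_dvd.2 (not_dvd 0 0 (by simp) (by simp))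
  rw [bubble, mul_pow, mul_pow]
  exact (r0.pow.mul_left r1.pow).mul_dvd (r01.pow.mul_dvd h0 h1) h2

/-- The curl of `bubble ^ 2 * q`, as a linear function of `q`. -/
noncomputable def curlBubbleSq :
    MvPolynomial (Fin 2) ℝ →ₗ[ℝ] MvPolynomial (Fin 2) ℝ × MvPolynomial (Fin 2) ℝ :=
  ((pderiv (1 : Fin 2)).toLinearMap.prod (-(pderiv (0 : Fin 2)).toLinearMap)).comp
    (LinearMap.mulLeft ℝ (bubble ^ 2))

theorem curlBubbleSq_apply (q : MvPolynomial (Fin 2) ℝ) :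
    curlBubbleSq q = (pderiv 1 (bubble ^ 2 * q), -pderiv 0 (bubble ^ 2 * q)) := rfl

theorem curlBubbleSq_injective : Function.Injective curlBubbleSq := by
  rw [← LinearMap.ker_eq_bot, LinearMap.ker_eq_bot']
  intro q hq
  have h : pderiv 1 (bubble ^ 2 * q) = 0 := congrArg Prod.fst hq
  have hX : X 1 ∣ bubble ^ 2 * q := by
    refine Dvd.dvd.mul_right (dvd_pow ?_ two_ne_zero) q
    exact (dvd_mul_left _ _).mul_right _
  exact (mul_eq_zero.1 (eq_zero_of_X_dvd_of_pderiv_eq_zero hX h)).resolve_left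
    (pow_ne_zero 2 bubble_ne_zero)

theorem eval_pderiv_bubble_sq_mul (i : Fin 2) (q : MvPolynomial (Fin 2) ℝ) {x y : ℝ}
    (h : OnBdryT x y) : eval ![x, y] (pderiv i (bubble ^ 2 * q)) = 0 := by
  simp [eval_bubble_eq_zero h]

theorem curlBubbleSq_mem_Zspace {n : ℕ} {q : MvPolynomial (Fin 2) ℝ} (hq : q.totalDegree ≤ n) :
    curlBubbleSq q ∈ Zspace (n + 5) := by
  have hdeg : (bubble ^ 2 * q).totalDegree ≤ n + 5 + 1 := by
    rcases eq_or_ne q 0 with rfl | h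
    · simp
    · rw [totalDegree_bubble_sq_mul h]; omega
  rw [curlBubbleSq_apply]
  refine ⟨totalDegree_pderiv_le _ hdeg, ?_, fun x y h => ⟨?_, ?_⟩, ?_⟩
  · rw [totalDegree_neg]; exact totalDegree_pderiv_le _ hdeg
  · exact eval_pderiv_bubble_sq_mul _ _ h
  · rw [map_neg, eval_pderiv_bubble_sq_mul _ _ h, neg_zero]
  · rw [map_neg, pderiv_pderiv_comm, add_neg_cancel]

/-- A divergence-free field vanishing on the boundary of the triangle has a stream function
divisible by `bubble ^ 2`. -/
theorem exists_curlBubbleSq_eq {n : ℕ} {v : MvPolynomial (Fin 2) ℝ × MvPolynomial (Fin 2) ℝ}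
    (hv : v ∈ Zspace (n + 5)) : ∃ q, q.totalDegree ≤ n ∧ curlBubbleSq q = v := by
  obtain ⟨u, w⟩ := v
  obtain ⟨hu, -, hbd, hdiv⟩ := hv
  have hbu := fun x y h => (hbd x y h).1
  have hbw := fun x y h => (hbd x y h).2
  simp only at hu hbu hbw hdiv
  set φ := antideriv ℝ 1 u with hφ
  have h1φ : X 1 ∣ φ := X_dvd_antideriv 1 u
  have hφ1 : pderiv 1 φ = u := pderiv_antideriv 1 u
  have hφ0 : pderiv 0 φ = -w := by
    rw [← sub_eq_zero, sub_neg_eq_add]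
    refine eq_zero_of_X_dvd_of_pderiv_eq_zero (i := 1) (dvd_add ?_ (X_one_dvd hbw)) ?_
    · obtain ⟨c, hc⟩ := h1φ
      rw [hc, pderiv_mul, pderiv_X_of_ne (by decide), zero_mul, zero_add]
      exact dvd_mul_right _ _
    · rw [map_add, pderiv_pderiv_comm, hφ1, hdiv]
  have h0φ : X 0 ∣ φ := by
    obtain ⟨c, hc⟩ := X_zero_dvd hbu
    rw [hφ, hc, antideriv_X_mul (by decide)]
    exact dvd_mul_right _ _
  have hlφ : 1 - X 0 - X 1 ∣ φ := by
    refine one_sub_X_sub_X_dvd_of_aeval_eq_zero ?_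
    have hder := derivative_aeval ![1 - Polynomial.X, (Polynomial.X : Polynomial ℝ)] φ
    rw [Fin.sum_univ_two, hφ0, hφ1, map_neg, aeval_hypotenuse_eq_zero hbu,
      aeval_hypotenuse_eq_zero hbw, neg_zero, zero_mul, zero_mul, add_zero] at hder
    have hC := Polynomial.eq_C_of_derivative_eq_zero hder
    have h0 : (aeval ![1 - Polynomial.X, (Polynomial.X : Polynomial ℝ)] φ).coeff 0 = 0 := by
      obtain ⟨c, hc⟩ := h1φ
      simp [hc]
    rw [hC, h0, Polynomial.C_0]
  obtain ⟨q, hq⟩ := bubble_sq_dvd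
    (sq_dvd_of_dvd_of_dvd_pderiv 0 (by simp) h0φ (by rw [hφ0]; exact (X_zero_dvd hbw).neg_right))
    (sq_dvd_of_dvd_of_dvd_pderiv 1 (by simp) h1φ (by rw [hφ1]; exact X_one_dvd hbu))
    (sq_dvd_of_dvd_of_dvd_pderiv 1 (by simp) hlφ (by
      rw [hφ1]; exact one_sub_X_sub_X_dvd_of_aeval_eq_zero (aeval_hypotenuse_eq_zero hbu)))
  refine ⟨q, ?_, ?_⟩
  · rcases eq_or_ne q 0 with rfl | h
    · simp
    · have := totalDegree_bubble_sq_mul h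
      have := (totalDegree_antideriv_le 1 u).trans (Nat.add_le_add_right hu 1)
      rw [← hφ, hq] at this
      omega
  · rw [curlBubbleSq_apply, ← hq, hφ0, hφ1, neg_neg]

theorem Zspace_eq_map (n : ℕ) :
    Zspace (n + 5) = (restrictTotalDegree (Fin 2) ℝ n).map curlBubbleSq := by
  ext v
  simp only [Submodule.mem_map, mem_restrictTotalDegree]
  refine ⟨exists_curlBubbleSq_eq, ?_⟩
  rintro ⟨q, hq, rfl⟩
  exact curlBubbleSq_mem_Zspace hq

/-- For `k ≥ 5`, the space `Z^k(T̂)` of divergence-free polynomial vector fields of total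
degree at most `k` vanishing on the boundary of the reference triangle has dimension
`(k−4)(k−3)/2`. -/
theorem dim_Zspace (k : ℕ) (hk : 5 ≤ k) :
    Module.finrank ℝ (Zspace k) = (k - 4) * (k - 3) / 2 := by
  obtain ⟨n, rfl⟩ := Nat.exists_eq_add_of_le' hk
  rw [Zspace_eq_map,
    ← (Submodule.equivMapOfInjective _ curlBubbleSq_injective _).finrank_eq,
    finrank_restrictTotalDegree_fin_two]
  rfl
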